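/- There do not exist a natural number n ≥ 2 and integers m, s, d with m ∉ {0, 1, −1}, gcd(m, s) = 1, such that both m^(n−1) divides (n−1)·d·(n−1)! − s·n! and m^n divides n·d·(n−1)! − s·n!. -/

import Mathlib

open Nat

lemma not_prime_pow_dvd_factorial (p k : ℕ) (hp : p.Prime) (hk : k ≠ 0) : ¬ p ^ k ∣ k ! := by
  intro h
  have := Fact.mk hp
  have h1 := sub_one_mul_padicValNat_factorial_lt_of_ne_zero p hk
  have h2 := (padicValNat_dvd_iff_le (p := p) (Nat.factorial_ne_zero k)).1 h
  have h3 := hp.two_le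
  have h4 : 1 * padicValNat p k ! ≤ (p - 1) * padicValNat p k ! :=
    Nat.mul_le_mul_right _ (by omega)
  omega

lemma prime_dvd_of_pow_dvd (p k : ℕ) (hp : p.Prime) (hk : k ≠ 0) (x : ℤ)
    (h : (p : ℤ) ^ k ∣ (k ! : ℤ) * x) : (p : ℤ) ∣ x := by
  by_contra hx
  have hc : IsCoprime ((p : ℤ) ^ k) x :=
    IsCoprime.pow_left ((Nat.prime_iff_prime_int.1 hp).coprime_iff_not_dvd.2 hx)
  have := hc.dvd_of_dvd_mul_right h
  exact not_prime_pow_dvd_factorial p k hp hk (by exact_mod_cast this)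

/-- The arithmetic core of Lemma 14: there is no `n ≥ 2` and integers `m, s, d`
with `m ∉ {0, 1, -1}`, `gcd(m, s) = 1`, such that `m^(n-1)` divides
`(n-1)·d·(n-1)! - s·n!` and `m^n` divides `n·d·(n-1)! - s·n!`. -/
theorem no_such_divisibilities :
    ¬ ∃ (n : ℕ) (m s d : ℤ), 2 ≤ n ∧ m ≠ 0 ∧ m ≠ 1 ∧ m ≠ -1 ∧ IsCoprime m s ∧
      m ^ (n - 1) ∣ (((n : ℤ) - 1) * d * ((n - 1)! : ℤ) - s * (n ! : ℤ)) ∧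
      m ^ n ∣ ((n : ℤ) * d * ((n - 1)! : ℤ) - s * (n ! : ℤ)) := by
  rintro ⟨n, m, s, d, hn, -, h1, h2, hc, hA, hB⟩
  obtain ⟨p, hp, hpm⟩ := Nat.exists_prime_and_dvd (n := m.natAbs) (by omega)
  have hpm' : (p : ℤ) ∣ m := Int.natCast_dvd.2 hpm
  have hf : (n ! : ℤ) = n * ((n - 1)! : ℤ) := by
    exact_mod_cast (Nat.mul_factorial_pred (by omega : n ≠ 0)).symm
  have hB' : (p : ℤ) ∣ d - s := by
    apply prime_dvd_of_pow_dvd p n hp (by omega)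
    have e := dvd_trans (pow_dvd_pow_of_dvd hpm' n) hB
    refine e.trans (dvd_of_eq ?_)
    rw [hf]; ring
  have hA' : (p : ℤ) ∣ ((n : ℤ) - 1) * (d - s) - s := by
    apply prime_dvd_of_pow_dvd p (n - 1) hp (by omega)
    have e := dvd_trans (pow_dvd_pow_of_dvd hpm' (n - 1)) hA
    refine e.trans (dvd_of_eq ?_)
    rw [hf]; ring
  have hs : (p : ℤ) ∣ s := by
    have := dvd_sub (Dvd.dvd.mul_left hB' ((n : ℤ) - 1)) hA'
    simpa using this
  exact (Nat.prime_iff_prime_int.1 hp).not_isUnit (hc.isUnit_of_dvd' hpm' hs)
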